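/- Fix J > 0 and φ ∈ ℝ. Then the phase density of the calibrated endpoint estimate under the circular complex Gaussian residual model satisfies the closed form ∫_0^∞ (ρ/(π·J))·exp(−(ρ² − 2ρ·cos φ + 1)/J) dρ = (1/(2π))·[ exp(−1/J) + (2·cos φ/√J)·exp(−sin²φ/J)·∫_{−cos φ/√J}^∞ exp(−u²) du ]. -/

import Mathlib

open MeasureTheory Real

lemma aux_int_mul (a : ℝ) :
    ∫ u in Set.Ioi a, u * Real.exp (-u ^ 2) = (1 / 2) * Real.exp (-a ^ 2) := by
  have hi : Integrable (fun u : ℝ => u * Real.exp (-u ^ 2)) := by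
    simpa using integrable_mul_exp_neg_mul_sq (b := 1) one_pos
  have ht : Filter.Tendsto (fun u : ℝ => -(1 / 2) * Real.exp (-u ^ 2)) Filter.atTop (nhds 0) := by
    have h1 : Filter.Tendsto (fun u : ℝ => Real.exp (-u ^ 2)) Filter.atTop (nhds 0) :=
      Real.tendsto_exp_neg_atTop_nhds_zero.comp (Filter.tendsto_pow_atTop two_ne_zero)
    simpa using h1.const_mul (-(1 / 2) : ℝ)
  have h := integral_Ioi_of_hasDerivAt_of_tendsto' (a := a)
    (f := fun u : ℝ => -(1 / 2) * Real.exp (-u ^ 2)) (f' := fun u : ℝ => u * Real.exp (-u ^ 2))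
    (fun x _ => by
      have := (((hasDerivAt_id x).pow 2).neg.exp).const_mul (-(1 / 2) : ℝ)
      refine (this.congr_deriv ?_)
      simp
      ring) hi.integrableOn ht
  rw [h]
  ring

lemma aux_subst (F : ℝ → ℝ) (s c : ℝ) (hs : 0 < s) :
    ∫ x in Set.Ioi (0 : ℝ), F x = s * ∫ u in Set.Ioi (-c / s), F (s * u + c) := by
  have h1 := integral_comp_mul_left_Ioi' (fun x => F (x + c)) (-c / s) hs
  rw [smul_eq_mul] at h1
  rw [h1, mul_div_cancel₀ _ hs.ne']
  have h2 := (measurePreserving_add_right volume c).setIntegral_preimage_emb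
    (MeasurableEquiv.addRight c).measurableEmbedding F (Set.Ioi 0)
  rw [← h2]
  simp

/-- Closed form of the endpoint phase density under a circular complex Gaussian
residual of variance `J`:
`∫_0^∞ (ρ/(πJ))·exp(−(ρ² − 2ρ·cos φ + 1)/J) dρ
  = (1/(2π))·[exp(−1/J) + (2 cos φ/√J)·exp(−sin²φ/J)·∫_{−cos φ/√J}^∞ exp(−u²) du]`. -/
theorem stmt_15 (J φ : ℝ) (hJ : 0 < J) :
    (∫ ρ in Set.Ioi (0 : ℝ),
        (ρ / (Real.pi * J)) * Real.exp (-(ρ ^ 2 - 2 * ρ * Real.cos φ + 1) / J))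
      = (1 / (2 * Real.pi)) *
        (Real.exp (-1 / J) +
          (2 * Real.cos φ / Real.sqrt J) * Real.exp (-(Real.sin φ) ^ 2 / J) *
            ∫ u in Set.Ioi (-Real.cos φ / Real.sqrt J), Real.exp (-u ^ 2)) := by
  have hs : 0 < Real.sqrt J := Real.sqrt_pos.mpr hJ
  have hss : Real.sqrt J ^ 2 = J := Real.sq_sqrt hJ.le
  rw [aux_subst _ (Real.sqrt J) (Real.cos φ) hs]
  set s := Real.sqrt J with hsdef
  set c := Real.cos φ with hc
  have hsc : Real.sin φ ^ 2 = 1 - c ^ 2 := by rw [hc, Real.sin_sq]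
  have hi1 : Integrable (fun u : ℝ => u * Real.exp (-u ^ 2)) := by
    simpa using integrable_mul_exp_neg_mul_sq (b := 1) one_pos
  have hi0 : Integrable (fun u : ℝ => Real.exp (-u ^ 2)) := by
    simpa using integrable_exp_neg_mul_sq (b := 1) one_pos
  have hfun : ∀ u : ℝ, (s * u + c) / (Real.pi * J) *
      Real.exp (-((s * u + c) ^ 2 - 2 * (s * u + c) * c + 1) / J)
      = (Real.exp (-(Real.sin φ) ^ 2 / J) / (Real.pi * J) * s) * (u * Real.exp (-u ^ 2))
        + (Real.exp (-(Real.sin φ) ^ 2 / J) / (Real.pi * J) * c) * Real.exp (-u ^ 2) := by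
    intro u
    have : -((s * u + c) ^ 2 - 2 * (s * u + c) * c + 1) / J
        = -(Real.sin φ) ^ 2 / J + -u ^ 2 := by
      rw [hsc]
      field_simp
      rw [← hss]
      ring
    rw [this, Real.exp_add]
    ring
  simp_rw [hfun]
  rw [integral_add (hi1.integrableOn.const_mul _) (hi0.integrableOn.const_mul _),
    integral_const_mul, integral_const_mul, aux_int_mul]
  have he : Real.exp (-1 / J) = Real.exp (-(Real.sin φ) ^ 2 / J) * Real.exp (-(-c / s) ^ 2) := by
    rw [← Real.exp_add, hsc, div_pow, hss]
    congr 1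
    field_simp
    ring
  rw [he]
  generalize (∫ u in Set.Ioi (-c / s), Real.exp (-u ^ 2)) = I
  generalize Real.exp (-(-c / s) ^ 2) = A
  generalize Real.exp (-(Real.sin φ) ^ 2 / J) = B
  rw [← hss]
  have := Real.pi_pos.ne'
  have := hs.ne'
  field_simp
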